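/- arXiv:1811.05662 — 7 statements merged into one kernel-verified Lean document; each statement's English description precedes it below -/
import Mathlib

section
/- Let (X, 𝔸, d) be a C*-algebra valued metric space, I an admissible ideal on ℕ, and (x_n) a sequence in X. If for every ε > 0 there exists a set D ∈ I such that ‖d(x_m, x_n)‖ < ε for all m, n ∉ D, then for every ε > 0 the set {k ∈ ℕ : E_k(ε) ∉ I} belongs to I, where E_k(ε) = {n ∈ ℕ : ‖d(x_n, x_k)‖ ≥ ε}. -/
/-- (2) ⟹ (3) of the Cauchy characterisation. -/
theorem pair_condition_implies_Ek_condition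
    {X : Type*} {𝔸 : Type*} [CStarAlgebra 𝔸] [PartialOrder 𝔸] [StarOrderedRing 𝔸]
    (d : X → X → 𝔸)
    (d_nonneg : ∀ x y : X, 0 ≤ d x y)
    (d_eq_zero_iff : ∀ x y : X, d x y = 0 ↔ x = y)
    (d_symm : ∀ x y : X, d x y = d y x)
    (d_triangle : ∀ x y z : X, d x y ≤ d x z + d z y)
    (I : Set (Set ℕ))
    (I_union : ∀ A B : Set ℕ, A ∈ I → B ∈ I → A ∪ B ∈ I)
    (I_subset : ∀ A B : Set ℕ, A ∈ I → B ⊆ A → B ∈ I)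
    (I_admissible : ∀ n : ℕ, ({n} : Set ℕ) ∈ I)
    (x : ℕ → X)
    (hx : ∀ ε : ℝ, 0 < ε → ∃ D ∈ I, ∀ m ∉ D, ∀ n ∉ D, ‖d (x m) (x n)‖ < ε) :
    ∀ ε : ℝ, 0 < ε → {k : ℕ | {n : ℕ | ε ≤ ‖d (x n) (x k)‖} ∉ I} ∈ I := by
  intro ε hε
  obtain ⟨D, hD, h⟩ := hx ε hε
  refine I_subset D _ hD ?_
  intro k hk
  by_contra hkD
  apply hk
  refine I_subset D _ hD ?_
  intro n hn
  by_contra hnD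
  exact absurd (h n hnD k hkD) (not_lt.mpr hn)
end

section
/- Let (X, 𝔸, d) be a C*-algebra valued metric space and I an arbitrary admissible ideal on ℕ. If a sequence (x_n) in X is I-convergent to some ξ ∈ X with respect to 𝔸, then (x_n) is an I-Cauchy sequence with respect to 𝔸. -/
/-- An `I`-convergent sequence is `I`-Cauchy. -/
theorem i_convergent_implies_i_cauchy
    {X : Type*} {𝔸 : Type*} [CStarAlgebra 𝔸] [PartialOrder 𝔸] [StarOrderedRing 𝔸]
    (d : X → X → 𝔸)
    (d_nonneg : ∀ x y : X, 0 ≤ d x y)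
    (d_eq_zero_iff : ∀ x y : X, d x y = 0 ↔ x = y)
    (d_symm : ∀ x y : X, d x y = d y x)
    (d_triangle : ∀ x y z : X, d x y ≤ d x z + d z y)
    (I : Set (Set ℕ))
    (I_union : ∀ A B : Set ℕ, A ∈ I → B ∈ I → A ∪ B ∈ I)
    (I_subset : ∀ A B : Set ℕ, A ∈ I → B ⊆ A → B ∈ I)
    (I_admissible : ∀ n : ℕ, ({n} : Set ℕ) ∈ I)
    (x : ℕ → X) (ξ : X)
    (hx : ∀ ε : ℝ, 0 < ε → {n : ℕ | ε ≤ ‖d (x n) ξ‖} ∈ I) :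
    ∀ ε : ℝ, 0 < ε → ∃ n₀ : ℕ, {n : ℕ | ε ≤ ‖d (x n) (x n₀)‖} ∈ I := by
  intro ε hε
  have hA := hx (ε / 2) (half_pos hε)
  by_cases h : ∃ n₀ : ℕ, ‖d (x n₀) ξ‖ < ε / 2
  · obtain ⟨n₀, hn₀⟩ := h
    refine ⟨n₀, I_subset _ _ hA ?_⟩
    intro n hn
    simp only [Set.mem_setOf_eq] at hn ⊢
    have h1 : ‖d (x n) (x n₀)‖ ≤ ‖d (x n) ξ + d ξ (x n₀)‖ :=
      CStarAlgebra.norm_le_norm_of_nonneg_of_le (d_nonneg _ _) (d_triangle _ _ _)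
    have h2 := norm_add_le (d (x n) ξ) (d ξ (x n₀))
    rw [d_symm ξ (x n₀)] at h1 h2
    linarith
  · -- the whole of ℕ belongs to the ideal
    push Not at h
    exact ⟨0, I_subset _ _ hA (fun n _ => h n)⟩
end

section
/- Let (X, 𝔸, d) be a C*-algebra valued metric space and I an admissible ideal on ℕ. If a sequence (x_n) in X is an I*-Cauchy sequence with respect to 𝔸, then it is also an I-Cauchy sequence with respect to 𝔸. -/
/-- An `I*`-Cauchy sequence is `I`-Cauchy. -/
theorem i_star_cauchy_implies_i_cauchy
    {X : Type*} {𝔸 : Type*} [CStarAlgebra 𝔸] [PartialOrder 𝔸] [StarOrderedRing 𝔸]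
    (d : X → X → 𝔸)
    (d_nonneg : ∀ x y : X, 0 ≤ d x y)
    (d_eq_zero_iff : ∀ x y : X, d x y = 0 ↔ x = y)
    (d_symm : ∀ x y : X, d x y = d y x)
    (d_triangle : ∀ x y z : X, d x y ≤ d x z + d z y)
    (I : Set (Set ℕ))
    (I_union : ∀ A B : Set ℕ, A ∈ I → B ∈ I → A ∪ B ∈ I)
    (I_subset : ∀ A B : Set ℕ, A ∈ I → B ⊆ A → B ∈ I)
    (I_admissible : ∀ n : ℕ, ({n} : Set ℕ) ∈ I)
    (x : ℕ → X)
    (hx : ∃ m : ℕ → ℕ, StrictMono m ∧ (Set.range m)ᶜ ∈ I ∧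
      ∀ ε : ℝ, 0 < ε → ∃ N : ℕ, ∀ k p : ℕ, N < k → N < p → ‖d (x (m k)) (x (m p))‖ < ε) :
    ∀ ε : ℝ, 0 < ε → ∃ n₀ : ℕ, {n : ℕ | ε ≤ ‖d (x n) (x n₀)‖} ∈ I := by
  obtain ⟨m, -, hM, hC⟩ := hx
  intro ε hε
  obtain ⟨N, hN⟩ := hC ε hε
  have hfin : ∀ K : ℕ, (Set.range m)ᶜ ∪ Set.image m (Set.Iio K) ∈ I := by
    intro K
    induction K with
    | zero => exact I_subset _ _ hM (by simp)
    | succ K ih =>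
      refine I_subset _ _ (I_union _ _ ih (I_admissible (m K))) ?_
      rintro n (hn | ⟨k, hk, rfl⟩)
      · exact Or.inl (Or.inl hn)
      · rcases Nat.lt_succ_iff_lt_or_eq.mp hk with h | h
        · exact Or.inl (Or.inr ⟨k, h, rfl⟩)
        · exact Or.inr (by simp [h])
  refine ⟨m (N + 1), I_subset _ _ (hfin (N + 1)) ?_⟩
  intro n hn
  by_cases hr : n ∈ Set.range m
  · obtain ⟨k, rfl⟩ := hr
    refine Or.inr ⟨k, ?_, rfl⟩
    by_contra hk
    have hk2 : N < k := by
      simp only [Set.mem_Iio] at hk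
      omega
    exact absurd (hN k (N + 1) hk2 (Nat.lt_succ_self N)) (not_lt.mpr hn)
  · exact Or.inl hr
end

section
/- Let (X, 𝔸, d) be a C*-algebra valued metric space and I an admissible ideal on ℕ. If a sequence (x_n) in X is I*-convergent to some x ∈ X with respect to 𝔸, then (x_n) is an I-Cauchy sequence with respect to 𝔸. -/
/-- An `I*`-convergent sequence is `I`-Cauchy. -/
theorem i_star_convergent_implies_i_cauchy
    {X : Type*} {𝔸 : Type*} [CStarAlgebra 𝔸] [PartialOrder 𝔸] [StarOrderedRing 𝔸]
    (d : X → X → 𝔸)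
    (d_nonneg : ∀ x y : X, 0 ≤ d x y)
    (d_eq_zero_iff : ∀ x y : X, d x y = 0 ↔ x = y)
    (d_symm : ∀ x y : X, d x y = d y x)
    (d_triangle : ∀ x y z : X, d x y ≤ d x z + d z y)
    (I : Set (Set ℕ))
    (I_union : ∀ A B : Set ℕ, A ∈ I → B ∈ I → A ∪ B ∈ I)
    (I_subset : ∀ A B : Set ℕ, A ∈ I → B ⊆ A → B ∈ I)
    (I_admissible : ∀ n : ℕ, ({n} : Set ℕ) ∈ I)
    (x : ℕ → X) (x₀ : X)
    (hx : ∃ m : ℕ → ℕ, StrictMono m ∧ (Set.range m)ᶜ ∈ I ∧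
      ∀ ε : ℝ, 0 < ε → ∃ N : ℕ, ∀ k : ℕ, N ≤ k → ‖d (x (m k)) x₀‖ < ε) :
    ∀ ε : ℝ, 0 < ε → ∃ n₀ : ℕ, {n : ℕ | ε ≤ ‖d (x n) (x n₀)‖} ∈ I := by
  intro ε hε
  obtain ⟨m, -, hmI, hm⟩ := hx
  obtain ⟨N, hN⟩ := hm (ε / 2) (half_pos hε)
  refine ⟨m N, ?_⟩
  have key : ∀ K : ℕ, (Set.range m)ᶜ ∪ m '' Set.Iio K ∈ I := by
    intro K
    induction K with
    | zero => exact I_subset _ _ hmI (by simp)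
    | succ K ih =>
      refine I_subset _ _ (I_union _ _ ih (I_admissible (m K))) ?_
      rintro n (hn | ⟨k, hk, rfl⟩)
      · exact Or.inl (Or.inl hn)
      · rcases Nat.lt_succ_iff_lt_or_eq.mp hk with h | h
        · exact Or.inl (Or.inr ⟨k, h, rfl⟩)
        · subst h
          exact Or.inr rfl
  refine I_subset _ _ (key N) ?_
  intro n hn
  by_cases hr : n ∈ Set.range m
  · obtain ⟨k, rfl⟩ := hr
    refine Or.inr ⟨k, ?_, rfl⟩
    by_contra hk
    have hk' : N ≤ k := not_lt.mp hk
    have h1 := hN k hk'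
    have h2 := hN N le_rfl
    have h3 : ‖d (x (m k)) (x (m N))‖ ≤ ‖d (x (m k)) x₀ + d x₀ (x (m N))‖ :=
      CStarAlgebra.norm_le_norm_of_nonneg_of_le (d_nonneg _ _) (d_triangle _ _ _)
    have h4 := norm_add_le (d (x (m k)) x₀) (d x₀ (x (m N)))
    rw [d_symm x₀ (x (m N))] at h3 h4
    have h5 : ε ≤ ‖d (x (m k)) (x (m N))‖ := hn
    linarith
  · exact Or.inl hr
end

section
/- Let I be an admissible ideal on ℕ satisfying condition (AP), and let F(I) be the associated filter. If {P_i}_{i=1}^∞ is a countable collection of subsets of ℕ with P_i ∈ F(I) for each i, then there exists a set P ⊆ ℕ such that P ∈ F(I) and P \ P_i is finite for every i. -/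
/-- For an admissible ideal with property (AP): given countably many sets of the associated filter `F(I)`, there is a single `P ∈ F(I)` almost contained in each. -/
theorem ap_filter_lemma
    (I : Set (Set ℕ))
    (I_union : ∀ A B : Set ℕ, A ∈ I → B ∈ I → A ∪ B ∈ I)
    (I_subset : ∀ A B : Set ℕ, A ∈ I → B ⊆ A → B ∈ I)
    (I_admissible : ∀ n : ℕ, ({n} : Set ℕ) ∈ I)
    (I_AP : ∀ A : ℕ → Set ℕ, (∀ j, A j ∈ I) → (∀ i j, i ≠ j → Disjoint (A i) (A j)) →
      ∃ B : ℕ → Set ℕ, (∀ j, (symmDiff (A j) (B j)).Finite) ∧ (⋃ j, B j) ∈ I)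
    (P : ℕ → Set ℕ)
    (hP : ∀ i : ℕ, (P i)ᶜ ∈ I) :
    ∃ Q : Set ℕ, Qᶜ ∈ I ∧ ∀ i : ℕ, (Q \ P i).Finite := by
  classical
  obtain ⟨B, hB, hU⟩ := I_AP (fun j => {x | x ∉ P j ∧ ∀ k < j, x ∈ P k})
    (fun j => I_subset _ _ (hP j) (fun x hx => hx.1))
    (fun i j hij => by
      rw [Set.disjoint_left]
      rintro x ⟨h1, h2⟩ ⟨h3, h4⟩
      rcases lt_or_gt_of_ne hij with h | h
      · exact h1 (h4 i h)
      · exact h3 (h2 j h))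
  refine ⟨(⋃ j, B j)ᶜ, by rwa [compl_compl], fun i => ?_⟩
  refine ((Set.finite_Iic i).biUnion (fun j _ => hB j)).subset ?_
  rintro x ⟨hx, hxi⟩
  have hex : ∃ k, x ∉ P k := ⟨i, hxi⟩
  refine Set.mem_biUnion (x := Nat.find hex) (Nat.find_min' hex hxi) ?_
  refine Or.inl ⟨⟨Nat.find_spec hex, fun k hk => not_not.mp (Nat.find_min hex hk)⟩, ?_⟩
  exact fun h => hx (Set.mem_iUnion.mpr ⟨_, h⟩)
end

section
/- Let 𝔹 = ℓ^∞(S) be the C*-algebra of bounded complex-valued functions on S = [a, b] (a < b) with the sup-norm and complex-conjugation involution, fix f ∈ 𝔹 with ‖f‖_∞ > 1, and define d : ℝ × ℝ → 𝔹 by d(x, y) = (1/|x − y|)·f if x ≠ y and d(x, y) = 0 if x = y. Then for every nontrivial admissible ideal I on ℕ, the sequence x_n = 1/n is NOT an I-Cauchy sequence with respect to 𝔹; that is, there exists ε > 0 such that for every n₀ ∈ ℕ the set {n ∈ ℕ : ‖d(1/n, 1/n₀)‖_∞ ≥ ε} does not belong to I. -/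
/-- Let `𝔹 = ℓ^∞(S)` be the C*-algebra of bounded complex-valued functions
on `S = [a, b]` (with the sup-norm), fix `f ∈ 𝔹` with `‖f‖ > 1`, and let
`d x y = (1/|x - y|) • f` for `x ≠ y`, `d x x = 0`.  Then for every nontrivial admissible
ideal `I` on `ℕ`, the sequence `x_n = 1/n` is *not* `I`-Cauchy with respect to `𝔹`. -/
theorem one_div_n_not_i_cauchy_linfty_example
    (a b : ℝ) (hab : a < b)
    (f : lp (fun _ : Set.Icc a b => ℂ) ⊤) (hf : 1 < ‖f‖)
    (d : ℝ → ℝ → lp (fun _ : Set.Icc a b => ℂ) ⊤)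
    (hd : ∀ x y : ℝ, d x y = if x = y then 0 else (1 / |x - y|) • f)
    (I : Set (Set ℕ))
    (I_union : ∀ A B : Set ℕ, A ∈ I → B ∈ I → A ∪ B ∈ I)
    (I_subset : ∀ A B : Set ℕ, A ∈ I → B ⊆ A → B ∈ I)
    (I_admissible : ∀ n : ℕ, ({n} : Set ℕ) ∈ I)
    (I_nontrivial : I ≠ {∅} ∧ (Set.univ : Set ℕ) ∉ I) :
    ∃ ε : ℝ, 0 < ε ∧ ∀ n₀ : ℕ, {n : ℕ | ε ≤ ‖d (1 / (n : ℝ)) (1 / (n₀ : ℝ))‖} ∉ I := by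
  refine ⟨1, one_pos, fun n₀ h => I_nontrivial.2 ?_⟩
  refine I_subset _ _ (I_union _ _ h (I_admissible n₀)) ?_
  intro n _
  by_cases hn : n = n₀
  · right
    exact hn
  left
  have key : ∀ m : ℕ, 0 ≤ 1 / (m : ℝ) ∧ 1 / (m : ℝ) ≤ 1 := by
    intro m
    refine ⟨by positivity, ?_⟩
    rcases Nat.eq_zero_or_pos m with rfl | hm
    · simp
    · rw [div_le_one (by exact_mod_cast hm)]
      exact_mod_cast hm
  have hne : 1 / (n : ℝ) ≠ 1 / (n₀ : ℝ) := by
    intro h'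
    apply hn
    rw [one_div, one_div, inv_inj] at h'
    exact_mod_cast h'
  have hpos : 0 < |1 / (n : ℝ) - 1 / (n₀ : ℝ)| := abs_pos.mpr (sub_ne_zero.mpr hne)
  have hle : |1 / (n : ℝ) - 1 / (n₀ : ℝ)| ≤ 1 := by
    rw [abs_le]
    constructor <;> linarith [(key n).1, (key n).2, (key n₀).1, (key n₀).2]
  change 1 ≤ ‖d (1 / (n : ℝ)) (1 / (n₀ : ℝ))‖
  rw [hd, if_neg hne, norm_smul, Real.norm_of_nonneg (by positivity)]
  have h1 : 1 ≤ 1 / |1 / (n : ℝ) - 1 / (n₀ : ℝ)| := by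
    rw [le_div_iff₀ hpos]
    linarith
  nlinarith
end

section
/- For j ∈ ℕ let Δ_j = {2^{j−1}(2s − 1) : s = 1, 2, 3, …} (so the Δ_j partition the positive integers), and let I = {A ⊆ ℕ : A intersects only finitely many of the sets Δ_j}, a nontrivial admissible ideal on ℕ. Let 𝔸 = ℓ^∞(S) be the C*-algebra of bounded complex-valued functions on S = [a, b] (a < b) with the sup-norm, fix f ∈ 𝔸 with ‖f‖_∞ > 1, and define d : ℝ × ℝ → 𝔸 by d(x, y) = |x − y|·f. Define the sequence (x_n) in ℝ by x_n = 1/j whenever n ∈ Δ_j. Then (x_n) is NOT an I*-Cauchy sequence with respect to 𝔸; that is, there is no set M ∈ F(I) such that the subsequence of (x_n) indexed by M is Cauchy with respect to 𝔸. -/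
/-- `Δ j = {2^(j-1) * (2s - 1) : s = 1, 2, 3, …}` (for `j ≥ 1`). -/
def Delta (j : ℕ) : Set ℕ :=
  {n : ℕ | ∃ s : ℕ, 1 ≤ s ∧ n = 2 ^ (j - 1) * (2 * s - 1)}

/-- The nontrivial admissible ideal of subsets of `ℕ` intersecting only finitely many of the
sets `Δ j`, `j ≥ 1`. -/
def DeltaIdeal : Set (Set ℕ) :=
  {A : Set ℕ | {j : ℕ | 1 ≤ j ∧ (A ∩ Delta j).Nonempty}.Finite}

/-- Let `𝔸 = ℓ^∞(S)`, `S = [a, b]`, with the sup-norm, fix `f ∈ 𝔸` with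
`‖f‖ > 1`, and put `d x y = |x - y| • f`.  The sequence given by `x n = 1/j` for `n ∈ Δ j` is
*not* `I*`-Cauchy with respect to `𝔸`, where `I` is the ideal of sets meeting only finitely
many `Δ j`: there is no set `M ∈ F(I)` (i.e. with `Mᶜ ∈ I`), enumerated by a strictly
increasing sequence `m`, along which the subsequence is Cauchy. -/
theorem delta_sequence_is_not_i_star_cauchy
    (a b : ℝ) (hab : a < b)
    (f : lp (fun _ : Set.Icc a b => ℂ) ⊤) (hf : 1 < ‖f‖)
    (d : ℝ → ℝ → lp (fun _ : Set.Icc a b => ℂ) ⊤)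
    (hd : ∀ x y : ℝ, d x y = |x - y| • f)
    (x : ℕ → ℝ)
    (hx : ∀ j : ℕ, 1 ≤ j → ∀ n ∈ Delta j, x n = 1 / (j : ℝ)) :
    ¬ ∃ m : ℕ → ℕ, StrictMono m ∧ (Set.range m)ᶜ ∈ DeltaIdeal ∧
      ∀ ε : ℝ, 0 < ε → ∃ N : ℕ, ∀ k p : ℕ, N < k → N < p →
        ‖d (x (m k)) (x (m p))‖ < ε := by
  rintro ⟨m, hm, hI, hC⟩
  obtain ⟨J, hJ⟩ := Set.Finite.bddAbove hI
  have key : ∀ j : ℕ, J < j → 1 ≤ j → ∀ N : ℕ, ∃ k, N < k ∧ x (m k) = 1 / (j : ℝ) := by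
    intro j hj h1 N
    have hmem2 : 2 ^ (j - 1) * (2 * (m N + 2) - 1) ∈ Delta j := ⟨m N + 2, by omega, rfl⟩
    have hr2 : 2 ^ (j - 1) * (2 * (m N + 2) - 1) ∈ Set.range m := by
      by_contra hn
      have := hJ (show j ∈ {j : ℕ | 1 ≤ j ∧ ((Set.range m)ᶜ ∩ Delta j).Nonempty} from
        ⟨h1, _, hn, hmem2⟩)
      omega
    obtain ⟨k, hk⟩ := hr2
    refine ⟨k, ?_, ?_⟩
    · apply hm.lt_iff_lt.mp
      rw [hk]
      have : 1 ≤ 2 ^ (j - 1) := Nat.one_le_two_pow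
      calc m N < 1 * (2 * (m N + 2) - 1) := by omega
        _ ≤ _ := Nat.mul_le_mul_right _ this
    · rw [hk]
      exact hx j h1 _ hmem2
  have hpos : (0 : ℝ) < |1 / ((J + 1 : ℕ) : ℝ) - 1 / ((J + 2 : ℕ) : ℝ)| := by
    rw [abs_pos, sub_ne_zero]
    intro h
    rw [one_div, one_div, inv_inj] at h
    have := Nat.cast_injective h
    omega
  obtain ⟨N, hN⟩ := hC _ hpos
  obtain ⟨k, hk, hxk⟩ := key (J + 1) (by omega) (by omega) N
  obtain ⟨p, hp, hxp⟩ := key (J + 2) (by omega) (by omega) N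
  have h := hN k p hk hp
  rw [hd, hxk, hxp, norm_smul, Real.norm_eq_abs, abs_abs] at h
  nlinarith
end
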